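/- arXiv:1206.4295 — 2 statements merged into one kernel-verified Lean document; each statement's English description precedes it below -/
import Mathlib

section
/- (Hopf-type boundary point lemma for the torsion function.) Let 1 < p < ∞ and let Ω ⊂ ℝ^N be a bounded open set. Let y be C^1 on the closure of Ω, y > 0 in Ω, and a weak solution of −Δ_p y = 1 in Ω. Suppose B(z0, R) ⊆ Ω and x0 ∈ ∂B(z0,R) ∩ ∂Ω with y(x0) = 0. Then ⟨∇y(x0), (x0 − z0)/R⟩ < 0. -/
open MeasureTheory RealInnerProductSpace Metric Set

noncomputable section

/-- Smooth test functions compactly supported in `U` (the class `C_c^∞(U)`). -/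
def IsTestFun {N : ℕ} (U : Set (EuclideanSpace ℝ (Fin N)))
    (φ : EuclideanSpace ℝ (Fin N) → ℝ) : Prop :=
  ContDiff ℝ (⊤ : ℕ∞) φ ∧ HasCompactSupport φ ∧ tsupport φ ⊆ U

/-- `u` is a weak solution of `-Δ_p u = h` in `U`:
`∫_U |∇u|^{p-2} ⟨∇u, ∇φ⟩ = ∫_U h φ` for all test functions `φ`. -/
def IsWeakSolution (p : ℝ) {N : ℕ} (U : Set (EuclideanSpace ℝ (Fin N)))
    (u h : EuclideanSpace ℝ (Fin N) → ℝ) : Prop :=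
  ∀ φ : EuclideanSpace ℝ (Fin N) → ℝ, IsTestFun U φ →
    (∫ x in U, ‖gradient u x‖ ^ (p - 2) * ⟪gradient u x, gradient φ x⟫)
      = ∫ x in U, h x * φ x

/-- The `p`-torsional rigidity of `U`:
`E(U) = (p/(p-1)) ⬝ sup { ∫_U φ - (1/p) ∫_U |∇φ|^p : φ ∈ C_c^∞(U) }`. -/
def pTorsionalRigidity (p : ℝ) {N : ℕ} (U : Set (EuclideanSpace ℝ (Fin N))) : ℝ :=
  (p / (p - 1)) *
    sSup { r : ℝ | ∃ φ, IsTestFun U φ ∧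
      r = (∫ x in U, φ x) - (1 / p) * ∫ x in U, ‖gradient φ x‖ ^ p }

/-- The first Dirichlet eigenvalue of the `p`-Laplacian on `U`:
`λ₁(U) = inf { (∫_U |∇φ|^p)/(∫_U |φ|^p) : φ ∈ C_c^∞(U), φ ≢ 0 }`. -/
def pLambda1 (p : ℝ) {N : ℕ} (U : Set (EuclideanSpace ℝ (Fin N))) : ℝ :=
  sInf { r : ℝ | ∃ φ, IsTestFun U φ ∧ φ ≠ 0 ∧
    r = (∫ x in U, ‖gradient φ x‖ ^ p) / (∫ x in U, |φ x| ^ p) }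

/-- `f` is `C^1` on the closure of `U` (i.e. `C^1` on an open neighbourhood of it). -/
def C1OnClosure {N : ℕ} (U : Set (EuclideanSpace ℝ (Fin N)))
    (f : EuclideanSpace ℝ (Fin N) → ℝ) : Prop :=
  ∃ W, IsOpen W ∧ closure U ⊆ W ∧ ContDiffOn ℝ 1 f W

/-- `Ω` has a smooth boundary: it is the sublevel set of a smooth function whose
differential does not vanish on the boundary. -/
def HasSmoothBoundary {N : ℕ} (Ω : Set (EuclideanSpace ℝ (Fin N))) : Prop :=
  ∃ f : EuclideanSpace ℝ (Fin N) → ℝ, ContDiff ℝ (⊤ : ℕ∞) f ∧ Ω = f ⁻¹' Set.Iio 0 ∧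
    ∀ x ∈ frontier Ω, fderiv ℝ f x ≠ 0

/-- The index of the first coordinate. -/
def firstIdx (N : ℕ) (hN : 2 ≤ N) : Fin N := ⟨0, by omega⟩

/-- The first standard basis vector `e₁`. -/
def e1v {N : ℕ} (hN : 2 ≤ N) : EuclideanSpace ℝ (Fin N) :=
  EuclideanSpace.single (firstIdx N hN) 1

/-- The domain `Ω(s) = B(0,r1) \ closure B(s e₁, r0)`. -/
def annulus {N : ℕ} (hN : 2 ≤ N) (r0 r1 s : ℝ) : Set (EuclideanSpace ℝ (Fin N)) :=
  Metric.ball (0 : EuclideanSpace ℝ (Fin N)) r1 \ closure (Metric.ball (s • e1v hN) r0)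

/-- Reflection across the hyperplane `{x₁ = s}`: `x ↦ (2s - x₁, x₂, …, x_N)`. -/
def reflectH {N : ℕ} (hN : 2 ≤ N) (s : ℝ) (x : EuclideanSpace ℝ (Fin N)) :
    EuclideanSpace ℝ (Fin N) :=
  x + (2 * (s - x (firstIdx N hN))) • e1v hN

/-- The divergence of a vector field, as the trace of its Jacobian. -/
def divergence {N : ℕ} (V : EuclideanSpace ℝ (Fin N) → EuclideanSpace ℝ (Fin N))
    (x : EuclideanSpace ℝ (Fin N)) : ℝ :=
  LinearMap.trace ℝ _ (fderiv ℝ V x : EuclideanSpace ℝ (Fin N) →ₗ[ℝ] EuclideanSpace ℝ (Fin N))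

/-- The classical `p`-Laplacian `Δ_p b = div(|∇b|^{p-2} ∇b)` at a point. -/
def pLapAt (p : ℝ) {N : ℕ} (b : EuclideanSpace ℝ (Fin N) → ℝ)
    (x : EuclideanSpace ℝ (Fin N)) : ℝ :=
  divergence (fun z => ‖gradient b z‖ ^ (p - 2) • gradient b z) x

/-- The torsion function of `U`: `C^1` up to the boundary, vanishing on the boundary,
positive inside, weak solution of `-Δ_p y = 1`. -/
def IsTorsionFn (p : ℝ) {N : ℕ} (U : Set (EuclideanSpace ℝ (Fin N)))
    (y : EuclideanSpace ℝ (Fin N) → ℝ) : Prop :=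
  C1OnClosure U y ∧ (∀ x ∈ frontier U, y x = 0) ∧ (∀ x ∈ U, 0 < y x) ∧
    IsWeakSolution p U y (fun _ => 1)

/-- A first eigenfunction of the Dirichlet `p`-Laplacian on `U`: `C^1` up to the boundary,
positive inside, vanishing on the boundary, `L^p`-normalized, weak solution of
`-Δ_p u = λ₁(U) u^{p-1}`. -/
def IsFirstEigenfun (p : ℝ) {N : ℕ} (U : Set (EuclideanSpace ℝ (Fin N)))
    (y : EuclideanSpace ℝ (Fin N) → ℝ) : Prop :=
  C1OnClosure U y ∧ (∀ x ∈ U, 0 < y x) ∧ (∀ x ∈ frontier U, y x = 0) ∧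
    (∫ x in U, y x ^ p) = 1 ∧
    IsWeakSolution p U y (fun x => pLambda1 p U * y x ^ (p - 1))

/-- The matrix `DA(x) = |x|^{p-2} I + (p-2)|x|^{p-4} x xᵀ`,
the derivative of `A(x) = |x|^{p-2} x`. -/
def DA (p : ℝ) {N : ℕ} (x : EuclideanSpace ℝ (Fin N)) :
    EuclideanSpace ℝ (Fin N) →L[ℝ] EuclideanSpace ℝ (Fin N) :=
  ‖x‖ ^ (p - 2) • ContinuousLinearMap.id ℝ (EuclideanSpace ℝ (Fin N)) +
    ((p - 2) * ‖x‖ ^ (p - 4)) • (innerSL ℝ x).smulRight x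

/-- `w` is a nonnegative bounded weak solution, continuous on the closure of `Ω` and `C^1`
inside, of `-Δ_p w = F(x, w)` in `Ω` with boundary value `bdry` on `∂Ω`. -/
def SolClass (p : ℝ) {N : ℕ} (Ω : Set (EuclideanSpace ℝ (Fin N)))
    (F : EuclideanSpace ℝ (Fin N) → ℝ → ℝ)
    (bdry w : EuclideanSpace ℝ (Fin N) → ℝ) : Prop :=
  ContinuousOn w (closure Ω) ∧ ContDiffOn ℝ 1 w Ω ∧
    (∀ x ∈ closure Ω, 0 ≤ w x) ∧ (∃ M, ∀ x ∈ closure Ω, |w x| ≤ M) ∧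
    IsWeakSolution p Ω w (fun x => F x (w x)) ∧ (∀ x ∈ frontier Ω, w x = bdry x)

section Flux

variable {E : Type*} [NormedAddCommGroup E] [InnerProductSpace ℝ E]

/-- The nonlinearity `v ↦ |v|^{p-2} v` of the `p`-Laplacian. -/
def pFlux (p : ℝ) (v : E) : E := ‖v‖ ^ (p - 2) • v

theorem norm_pFlux {p : ℝ} (hp : 1 < p) (v : E) : ‖pFlux p v‖ = ‖v‖ ^ (p - 1) := by
  rw [pFlux, norm_smul, Real.norm_of_nonneg (by positivity),
    ← Real.rpow_add_one' (norm_nonneg v) (by linarith)]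
  ring_nf

theorem continuous_pFlux {p : ℝ} (hp : 1 < p) : Continuous (pFlux p : E → E) := by
  rw [continuous_iff_continuousAt]
  intro v
  by_cases hv : v = 0
  · subst hv
    have h0 : pFlux p (0 : E) = 0 := by simp [pFlux]
    rw [ContinuousAt, h0, tendsto_zero_iff_norm_tendsto_zero]
    simp_rw [norm_pFlux hp]
    have : Continuous fun x : E => ‖x‖ ^ (p - 1) :=
      continuous_norm.rpow_const fun _ => Or.inr (by linarith)
    simpa [sub_ne_zero_of_ne hp.ne'] using this.tendsto (0 : E)
  · exact (continuous_norm.continuousAt.rpow_const (Or.inl (norm_ne_zero_iff.2 hv))).smul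
      continuousAt_id

theorem inner_pFlux_sub_eq {p : ℝ} (hp : 1 < p) (u v : E) :
    (‖u‖ ^ (p - 1) - ‖v‖ ^ (p - 1)) * (‖u‖ - ‖v‖)
      + (‖u‖ ^ (p - 2) + ‖v‖ ^ (p - 2)) * (‖u‖ * ‖v‖ - ⟪u, v⟫)
      = ⟪pFlux p u - pFlux p v, u - v⟫ := by
  have hr (w : E) : ‖w‖ ^ (p - 1) = ‖w‖ ^ (p - 2) * ‖w‖ := by
    rw [← Real.rpow_add_one' (norm_nonneg w) (by linarith)]
    ring_nf
  simp only [pFlux, hr, inner_sub_left, inner_sub_right, real_inner_smul_left,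
    real_inner_self_eq_norm_sq, real_inner_comm u v]
  ring

theorem rpow_sub_mul_sub_nonneg {a b s : ℝ} (ha : 0 ≤ a) (hb : 0 ≤ b) (hs : 0 < s) :
    0 ≤ (a ^ s - b ^ s) * (a - b) := by
  rcases le_total a b with h | h
  · exact mul_nonneg_of_nonpos_of_nonpos
      (sub_nonpos.2 (Real.rpow_le_rpow ha h hs.le)) (sub_nonpos.2 h)
  · exact mul_nonneg (sub_nonneg.2 (Real.rpow_le_rpow hb h hs.le)) (sub_nonneg.2 h)

theorem inner_pFlux_sub_nonneg {p : ℝ} (hp : 1 < p) (u v : E) :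
    0 ≤ ⟪pFlux p u - pFlux p v, u - v⟫ := by
  rw [← inner_pFlux_sub_eq hp]
  exact add_nonneg (rpow_sub_mul_sub_nonneg (norm_nonneg u) (norm_nonneg v) (by linarith))
    (mul_nonneg (by positivity) (sub_nonneg.2 (real_inner_le_norm u v)))

theorem eq_of_inner_pFlux_sub_eq_zero {p : ℝ} (hp : 1 < p) {u v : E}
    (h : ⟪pFlux p u - pFlux p v, u - v⟫ = 0) : u = v := by
  have h1 := rpow_sub_mul_sub_nonneg (norm_nonneg u) (norm_nonneg v) (by linarith : 0 < p - 1)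
  have h2 : 0 ≤ (‖u‖ ^ (p - 2) + ‖v‖ ^ (p - 2)) * (‖u‖ * ‖v‖ - ⟪u, v⟫) :=
    mul_nonneg (by positivity) (sub_nonneg.2 (real_inner_le_norm u v))
  rw [← inner_pFlux_sub_eq hp] at h
  have huv : ‖u‖ = ‖v‖ := by
    rcases mul_eq_zero.1 (by linarith : (‖u‖ ^ (p - 1) - ‖v‖ ^ (p - 1)) * (‖u‖ - ‖v‖) = 0)
      with h3 | h3
    · exact (Real.rpow_left_inj (norm_nonneg u) (norm_nonneg v) (by linarith)).1
        (sub_eq_zero.1 h3)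
    · exact sub_eq_zero.1 h3
  rcases eq_or_ne u 0 with hu | hu
  · rw [hu, norm_zero] at huv
    rw [hu, norm_eq_zero.1 huv.symm]
  · have hupos : 0 < ‖u‖ := norm_pos_iff.2 hu
    have hfac : 0 < ‖u‖ ^ (p - 2) + ‖v‖ ^ (p - 2) := by positivity
    have hin : ‖u‖ * ‖v‖ - ⟪u, v⟫ = 0 :=
      (mul_eq_zero.1 (by linarith)).resolve_left hfac.ne'
    rw [← sub_eq_zero, ← norm_eq_zero, ← sq_eq_zero_iff, norm_sub_sq_real, ← huv]
    rw [← huv] at hin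
    linarith [hin]

end Flux

theorem exists_contDiff_fderiv_close {E : Type*} [NormedAddCommGroup E] [InnerProductSpace ℝ E]
    [FiniteDimensional ℝ E] [MeasurableSpace E] [BorelSpace E] {U : Set E} (hU : IsOpen U)
    {φ : E → ℝ} (hφ : ContDiff ℝ 1 φ) (hc : HasCompactSupport φ) (hs : tsupport φ ⊆ U)
    {ε : ℝ} (hε : 0 < ε) :
    ∃ ψ : E → ℝ, ContDiff ℝ (⊤ : ℕ∞) ψ ∧ HasCompactSupport ψ ∧ tsupport ψ ⊆ U ∧
      ∀ x, ‖fderiv ℝ ψ x - fderiv ℝ φ x‖ ≤ ε := by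
  obtain ⟨δ, hδ, hδU⟩ := hc.isCompact.exists_cthickening_subset_open hU hs
  have hφ' : Continuous (fderiv ℝ φ) := hφ.continuous_fderiv one_ne_zero
  obtain ⟨η, hη, hηε⟩ := Metric.uniformContinuous_iff.1
    (hφ'.uniformContinuous_of_tendsto_cocompact (hc.fderiv ℝ).is_zero_at_infty) ε hε
  have hr : 0 < min δ η := lt_min hδ hη
  let ρ : ContDiffBump (0 : E) := ⟨min δ η / 2, min δ η, half_pos hr, half_lt_self hr⟩
  have hsub : tsupport (convolution (ρ.normed volume) φ (ContinuousLinearMap.lsmul ℝ ℝ) volume)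
      ⊆ cthickening δ (tsupport φ) := by
    refine closure_minimal ?_ isClosed_cthickening
    refine (support_convolution_subset _).trans ?_
    rw [ρ.support_normed_eq]
    rintro _ ⟨a, ha, b, hb, rfl⟩
    refine thickening_subset_cthickening _ _ (mem_thickening_iff.2 ⟨b, subset_closure hb, ?_⟩)
    simpa [dist_eq_norm] using lt_of_lt_of_le (mem_ball_zero_iff.1 ha) (min_le_left δ η)
  refine ⟨convolution (ρ.normed volume) φ (ContinuousLinearMap.lsmul ℝ ℝ) volume, ?_, ?_,
    hsub.trans hδU, fun x => ?_⟩
  · exact ρ.hasCompactSupport_normed.contDiff_convolution_left _ ρ.contDiff_normed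
      hφ.continuous.locallyIntegrable
  · exact hc.isCompact.cthickening.of_isClosed_subset (isClosed_tsupport _) hsub
  · rw [(hc.hasFDerivAt_convolution_right (ContinuousLinearMap.lsmul ℝ ℝ)
      ρ.continuous_normed.locallyIntegrable hφ x).fderiv, ← dist_eq_norm]
    exact ρ.dist_normed_convolution_le hφ'.aestronglyMeasurable
      fun z hz => (hηε (lt_of_lt_of_le hz (min_le_right δ η))).le

theorem norm_gradient_sub {E : Type*} [NormedAddCommGroup E] [InnerProductSpace ℝ E]
    [CompleteSpace E] (f g : E → ℝ) (x : E) :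
    ‖gradient f x - gradient g x‖ = ‖fderiv ℝ f x - fderiv ℝ g x‖ := by
  rw [gradient, gradient, ← map_sub, LinearIsometryEquiv.norm_map]

theorem ContDiffOn.continuousOn_gradient {E : Type*} [NormedAddCommGroup E]
    [InnerProductSpace ℝ E] [CompleteSpace E] {f : E → ℝ} {W : Set E}
    (hf : ContDiffOn ℝ 1 f W) (hW : IsOpen W) : ContinuousOn (gradient f) W :=
  (InnerProductSpace.toDual ℝ E).symm.continuous.comp_continuousOn
    (hf.continuousOn_fderiv_of_isOpen hW le_rfl)

/-- A vector field that is weakly divergence free against smooth test functions is so against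
`C^1` compactly supported functions. -/
theorem setIntegral_inner_gradient_eq_zero {N : ℕ} {U : Set (EuclideanSpace ℝ (Fin N))}
    (hU : IsOpen U) {G : EuclideanSpace ℝ (Fin N) → EuclideanSpace ℝ (Fin N)}
    (hG : IntegrableOn G U)
    (h : ∀ ψ, IsTestFun U ψ → ∫ x in U, ⟪G x, gradient ψ x⟫ = 0)
    {φ : EuclideanSpace ℝ (Fin N) → ℝ} (hφ : ContDiff ℝ 1 φ) (hc : HasCompactSupport φ)
    (hs : tsupport φ ⊆ U) : ∫ x in U, ⟪G x, gradient φ x⟫ = 0 := by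
  have hint {ψ : EuclideanSpace ℝ (Fin N) → ℝ} (hψ : ContDiff ℝ 1 ψ)
      (hψc : HasCompactSupport ψ) : IntegrableOn (fun x => ⟪G x, gradient ψ x⟫) U := by
    have hcont : Continuous (fderiv ℝ ψ) := hψ.continuous_fderiv one_ne_zero
    obtain ⟨C, hC⟩ := (hψc.fderiv ℝ).exists_bound_of_continuous hcont
    refine (hG.norm.const_mul C).mono' (hG.aestronglyMeasurable.inner
      ((InnerProductSpace.toDual ℝ _).symm.continuous.comp hcont).aestronglyMeasurable) ?_
    refine Filter.Eventually.of_forall fun x => (norm_inner_le_norm _ _).trans ?_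
    rw [mul_comm]
    gcongr
    simpa [gradient] using hC x
  by_contra hne
  set I := ∫ x in U, ⟪G x, gradient φ x⟫
  set M := ∫ x in U, ‖G x‖
  have hM : 0 ≤ M := integral_nonneg fun _ => norm_nonneg _
  have hI : 0 < |I| := abs_pos.2 hne
  obtain ⟨ψ, hψ, hψc, hψU, hclose⟩ := exists_contDiff_fderiv_close hU hφ hc hs
    (div_pos hI (by linarith : 0 < M + 1))
  have hψ1 : ContDiff ℝ 1 ψ := hψ.of_le (by exact_mod_cast le_top)
  have hle : |I| ≤ ∫ x in U, |I| / (M + 1) * ‖G x‖ := by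
    have hI' : I = -∫ x in U, ⟪G x, gradient ψ x - gradient φ x⟫ := by
      simp_rw [inner_sub_right]
      rw [integral_sub (hint hψ1 hψc) (hint hφ hc), h ψ ⟨hψ, hψc, hψU⟩]
      simp [I]
    conv_lhs => rw [hI', abs_neg, ← Real.norm_eq_abs]
    refine norm_integral_le_of_norm_le (hG.norm.const_mul _)
      (Filter.Eventually.of_forall fun x => (norm_inner_le_norm _ _).trans ?_)
    rw [mul_comm, norm_gradient_sub]
    gcongr
    exact hclose x
  rw [integral_const_mul] at hle
  have : |I| / (M + 1) * M < |I| := by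
    rw [div_mul_eq_mul_div, div_lt_iff₀ (by linarith)]
    nlinarith
  exact absurd hle (not_le.2 this)

/-- The field `x ↦ x - z` has divergence `N`. -/
theorem integral_inner_sub_gradient {N : ℕ} (z : EuclideanSpace ℝ (Fin N))
    {φ : EuclideanSpace ℝ (Fin N) → ℝ} (hφ : ContDiff ℝ 1 φ) (hc : HasCompactSupport φ) :
    ∫ x, ⟪x - z, gradient φ x⟫ = -(N * ∫ x, φ x) := by
  have hφ' : Continuous (fderiv ℝ φ) := hφ.continuous_fderiv one_ne_zero
  have hcoord (i : Fin N) (x : EuclideanSpace ℝ (Fin N)) :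
      HasFDerivAt (fun x : EuclideanSpace ℝ (Fin N) => x i - z i)
        (EuclideanSpace.proj i : EuclideanSpace ℝ (Fin N) →L[ℝ] ℝ) x :=
    (EuclideanSpace.proj (𝕜 := ℝ) i).hasFDerivAt.sub_const _
  have hcont (i : Fin N) : Continuous fun x : EuclideanSpace ℝ (Fin N) => x i - z i := by
    fun_prop
  have hfd (i : Fin N) (x : EuclideanSpace ℝ (Fin N)) :
      fderiv ℝ (fun x : EuclideanSpace ℝ (Fin N) => x i - z i) x (EuclideanSpace.single i 1)
        = 1 := by
    rw [(hcoord i x).fderiv]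
    simp
  have hint (i : Fin N) : Integrable fun x : EuclideanSpace ℝ (Fin N) =>
      (x i - z i) * fderiv ℝ φ x (EuclideanSpace.single i 1) :=
    ((hcont i).mul (hφ'.clm_apply continuous_const)).integrable_of_hasCompactSupport
      ((hc.fderiv_apply ℝ _).mul_left)
  have hparts (i : Fin N) :
      ∫ x : EuclideanSpace ℝ (Fin N), (x i - z i) * fderiv ℝ φ x (EuclideanSpace.single i 1)
        = -∫ x, φ x := by
    rw [integral_mul_fderiv_eq_neg_fderiv_mul_of_integrable]
    · simp_rw [hfd, one_mul]
    · simp_rw [hfd, one_mul]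
      exact hφ.continuous.integrable_of_hasCompactSupport hc
    · exact hint i
    · exact ((hcont i).mul hφ.continuous).integrable_of_hasCompactSupport hc.mul_left
    · exact fun x _ => (hcoord i x).differentiableAt
    · exact fun x _ => hφ.differentiable one_ne_zero x
  have hsum (x : EuclideanSpace ℝ (Fin N)) : ⟪x - z, gradient φ x⟫
      = ∑ i, (x i - z i) * fderiv ℝ φ x (EuclideanSpace.single i 1) := by
    simp only [← inner_gradient_left, PiLp.inner_apply]
    refine Finset.sum_congr rfl fun i _ => ?_
    simp [mul_comm]
  simp_rw [hsum]
  rw [integral_finsetSum _ fun i _ => hint i]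
  simp [hparts]

theorem gradient_eq_zero_of_notMem_tsupport {E : Type*} [NormedAddCommGroup E]
    [InnerProductSpace ℝ E] [CompleteSpace E] {ψ : E → ℝ} {x : E} (hx : x ∉ tsupport ψ) :
    gradient ψ x = 0 := by
  have h : ψ =ᶠ[nhds x] fun _ => 0 := notMem_tsupport_iff_eventuallyEq.1 hx
  rw [h.gradient_eq, gradient_fun_const]

/-- Weak comparison principle for the `p`-Laplacian. -/
theorem le_of_weak_pLaplacian_eq {N : ℕ} {p : ℝ} (hp : 1 < p)
    {U W : Set (EuclideanSpace ℝ (Fin N))} (hU : IsOpen U) (hUb : Bornology.IsBounded U)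
    (hUne : U ≠ univ) (hW : IsOpen W) (hUW : closure U ⊆ W)
    {u v : EuclideanSpace ℝ (Fin N) → ℝ} (hu : ContDiffOn ℝ 1 u W) (hv : ContDiffOn ℝ 1 v W)
    (hbdry : ∀ x ∈ frontier U, v x ≤ u x)
    (hweak : ∀ ψ, IsTestFun U ψ →
      ∫ x in U, ⟪pFlux p (gradient v x) - pFlux p (gradient u x), gradient ψ x⟫ = 0) :
    ∀ x ∈ U, v x ≤ u x := by
  intro x hxU
  refine le_of_forall_pos_le_add fun ε hε => ?_
  have hcl : IsCompact (closure U) := hUb.isCompact_closure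
  set η := Real.smoothTransition
  have hη : ContDiff ℝ 1 η := Real.smoothTransition.contDiff
  set f : EuclideanSpace ℝ (Fin N) → ℝ := fun x => v x - u x - ε
  have hf : ContDiffOn ℝ 1 f W := (hv.sub hu).sub contDiffOn_const
  set φ : EuclideanSpace ℝ (Fin N) → ℝ := U.indicator fun x => η (f x) with hφdef
  set K := closure U ∩ f ⁻¹' Ici 0
  have hKclosed : IsClosed K :=
    (hf.continuousOn.mono hUW).preimage_isClosed_of_isClosed isClosed_closure isClosed_Ici
  have hKU : K ⊆ U := by
    rintro z ⟨hz, hz0⟩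
    by_contra hzU
    have hle := hbdry z ⟨hz, by rwa [hU.interior_eq]⟩
    have : 0 ≤ v z - u z - ε := hz0
    linarith
  have hφK : ∀ z, z ∉ K → φ z = 0 := by
    intro z hz
    refine indicator_apply_eq_zero.2 fun hzU => Real.smoothTransition.zero_of_nonpos ?_
    by_contra! hpos
    exact hz ⟨subset_closure hzU, hpos.le⟩
  have hts : tsupport φ ⊆ K :=
    closure_minimal (fun z hz => by_contra fun h => hz (hφK z h)) hKclosed
  have hφc : HasCompactSupport φ := hcl.of_isClosed_subset (isClosed_tsupport _)
    (hts.trans inter_subset_left)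
  have hφU : ∀ z ∈ U, φ =ᶠ[nhds z] fun x => η (f x) := fun z hz => by
    filter_upwards [hU.mem_nhds hz] with w hw
    exact indicator_of_mem hw _
  have hφ : ContDiff ℝ 1 φ := by
    refine contDiff_iff_contDiffAt.2 fun z => ?_
    by_cases hz : z ∈ K
    · refine ContDiffAt.congr_of_eventuallyEq ?_ (hφU z (hKU hz))
      exact hη.contDiffAt.comp z (hf.contDiffAt (hW.mem_nhds (hUW hz.1)))
    · refine (contDiffAt_const (c := (0 : ℝ))).congr_of_eventuallyEq ?_
      filter_upwards [hKclosed.isOpen_compl.mem_nhds hz] with w hw using hφK w hw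
  set G := fun x => pFlux p (gradient v x) - pFlux p (gradient u x)
  have hG : ContinuousOn G W :=
    ((continuous_pFlux hp).comp_continuousOn (hv.continuousOn_gradient hW)).sub
      ((continuous_pFlux hp).comp_continuousOn (hu.continuousOn_gradient hW))
  have hgφ : Continuous (gradient φ) :=
    continuousOn_univ.1 (hφ.contDiffOn.continuousOn_gradient isOpen_univ)
  have hGφ : ContinuousOn (fun x => ⟪G x, gradient φ x⟫) W := hG.inner hgφ.continuousOn
  have hgrad : ∀ z ∈ U, gradient φ z = deriv η (f z) • (gradient v z - gradient u z) := by
    intro z hz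
    have hzW := hW.mem_nhds (hUW (subset_closure hz))
    have hfz : HasFDerivAt f (fderiv ℝ v z - fderiv ℝ u z) z :=
      (((hv.contDiffAt hzW).differentiableAt one_ne_zero).hasFDerivAt.sub
        ((hu.contDiffAt hzW).differentiableAt one_ne_zero).hasFDerivAt).sub_const ε
    have hcomp : HasFDerivAt (fun x => η (f x))
        (deriv η (f z) • (fderiv ℝ v z - fderiv ℝ u z)) z :=
      (hη.differentiable one_ne_zero (f z)).hasDerivAt.comp_hasFDerivAt z hfz
    rw [(hφU z hz).gradient_eq, gradient, hcomp.fderiv]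
    simp [gradient]
  have hη' : ∀ t, 0 ≤ deriv η t := fun _ => Real.smoothTransition.monotone.deriv_nonneg
  have hzero := setIntegral_inner_gradient_eq_zero hU
    (((hG.mono hUW).integrableOn_compact hcl).mono_set subset_closure) hweak hφ hφc
    (hts.trans hKU)
  have hnn : ∀ z ∈ U, 0 ≤ ⟪G z, gradient φ z⟫ := fun z hz => by
    rw [hgrad z hz, real_inner_smul_right]
    exact mul_nonneg (hη' _) (inner_pFlux_sub_nonneg hp _ _)
  rw [setIntegral_eq_zero_iff_of_nonneg_ae
    ((ae_restrict_iff' hU.measurableSet).2 (Filter.Eventually.of_forall hnn))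
    (((hGφ.mono hUW).integrableOn_compact hcl).mono_set subset_closure)] at hzero
  have hEq := Measure.eqOn_open_of_ae_eq hzero hU
    (hGφ.mono (subset_closure.trans hUW)) continuousOn_const
  have hgrad0 : ∀ z, gradient φ z = 0 := by
    intro z
    by_cases hz : z ∈ U
    · have h0 : ⟪G z, gradient φ z⟫ = 0 := hEq hz
      rw [hgrad z hz, real_inner_smul_right] at h0
      rcases mul_eq_zero.1 h0 with h1 | h1
      · rw [hgrad z hz, h1, zero_smul]
      · rw [hgrad z hz, eq_of_inner_pFlux_sub_eq_zero hp h1, sub_self, smul_zero]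
    · exact gradient_eq_zero_of_notMem_tsupport fun h => hz (hKU (hts h))
  obtain ⟨w, hw⟩ := (ne_univ_iff_exists_notMem U).1 hUne
  have hconst : φ x = φ w := is_const_of_fderiv_eq_zero (𝕜 := ℝ)
    (hφ.differentiable one_ne_zero) (fun z => by rw [← toDual_gradient, hgrad0, map_zero]) x w
  rw [hφdef, indicator_of_mem hxU, indicator_of_notMem hw,
    Real.smoothTransition.zero_iff_nonpos] at hconst
  have : v x - u x - ε ≤ 0 := hconst
  linarith

/-- The radial function with `-Δ_p b = 1` and zero boundary values on `∂B(z, R)`, up to the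
choice of the constant `κ`. -/
def radialBarrier (q κ R : ℝ) {N : ℕ} (z x : EuclideanSpace ℝ (Fin N)) : ℝ :=
  κ / q * (R ^ q - ‖x - z‖ ^ q)

theorem contDiff_radialBarrier {q : ℝ} (hq : 1 < q) (κ R : ℝ) {N : ℕ}
    (z : EuclideanSpace ℝ (Fin N)) : ContDiff ℝ 1 (radialBarrier q κ R z) :=
  contDiff_const.mul
    (contDiff_const.sub (ContDiff.norm_rpow (contDiff_id.sub contDiff_const) hq))

theorem gradient_radialBarrier {q : ℝ} (hq : 1 < q) (κ R : ℝ) {N : ℕ}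
    (z x : EuclideanSpace ℝ (Fin N)) :
    gradient (radialBarrier q κ R z) x = -(κ • pFlux q (x - z)) := by
  have h : HasFDerivAt (radialBarrier q κ R z) ((κ / q) •
      -((q * ‖x - z‖ ^ (q - 2)) • innerSL ℝ (x - z))) x := by
    refine HasFDerivAt.const_mul (HasFDerivAt.const_sub ?_ _) _
    exact (hasFDerivAt_norm_rpow (x - z) hq).comp x ((hasFDerivAt_id x).sub_const z)
  refine ext_inner_right ℝ fun w => ?_
  rw [inner_gradient_left, h.fderiv]
  simp only [pFlux, inner_neg_left, real_inner_smul_left, smul_apply, neg_apply,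
    innerSL_apply_apply, smul_eq_mul]
  field_simp

theorem pFlux_neg_smul_pFlux {E : Type*} [NormedAddCommGroup E] [InnerProductSpace ℝ E]
    {p q κ : ℝ} (hpq : p.HolderConjugate q) (hκ : 0 < κ) (w : E) :
    pFlux p (-(κ • pFlux q w)) = -(κ ^ (p - 1) • w) := by
  rcases eq_or_ne w 0 with rfl | hw
  · simp [pFlux]
  have hw' : 0 < ‖w‖ := norm_pos_iff.2 hw
  have hexp : (q - 1) * (p - 2) + (q - 2) = 0 := by
    linear_combination hpq.mul_eq_add
  have h1 : ‖-(κ • pFlux q w)‖ = κ * ‖w‖ ^ (q - 1) := by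
    rw [norm_neg, norm_smul, norm_pFlux hpq.symm.lt, Real.norm_of_nonneg hκ.le]
  rw [pFlux, h1, pFlux, smul_neg, smul_smul, smul_smul, Real.mul_rpow hκ.le (by positivity),
    ← Real.rpow_mul hw'.le]
  congr 2
  calc κ ^ (p - 2) * ‖w‖ ^ ((q - 1) * (p - 2)) * κ * ‖w‖ ^ (q - 2)
      = κ ^ (p - 2) * κ * (‖w‖ ^ ((q - 1) * (p - 2)) * ‖w‖ ^ (q - 2)) := by ring
    _ = κ ^ (p - 1) := by
      rw [← Real.rpow_add hw', hexp, Real.rpow_zero, ← Real.rpow_add_one hκ.ne', mul_one]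
      ring_nf

theorem inner_gradient_nonpos_of_le {E : Type*} [NormedAddCommGroup E] [InnerProductSpace ℝ E]
    [CompleteSpace E] {g : E → ℝ} {z x : E} (hg : DifferentiableAt ℝ g x)
    (hle : ∀ t : ℝ, 0 < t → t < 1 → g x ≤ g (x + t • (z - x))) :
    ⟪gradient g x, x - z⟫ ≤ 0 := by
  have hline : HasDerivAt (fun t : ℝ => g (x + t • (z - x))) (fderiv ℝ g x (z - x)) 0 :=
    hg.hasFDerivAt.hasLineDerivAt (z - x)
  have hnn : 0 ≤ fderiv ℝ g x (z - x) := by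
    refine ge_of_tendsto (hline.tendsto_slope_zero_right) ?_
    filter_upwards [Ioo_mem_nhdsGT (zero_lt_one' ℝ)] with t ht
    have := hle t ht.1 ht.2
    simp only [zero_add, zero_smul, add_zero, smul_eq_mul]
    exact mul_nonneg (inv_nonneg.2 ht.1.le) (by linarith)
  rw [← neg_sub z x, inner_neg_right, inner_gradient_left]
  linarith

theorem IsTestFun.eq_zero {N : ℕ} {V : Set (EuclideanSpace ℝ (Fin N))}
    {ψ : EuclideanSpace ℝ (Fin N) → ℝ} (hψ : IsTestFun V ψ) {x : EuclideanSpace ℝ (Fin N)}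
    (hx : x ∉ V) : ψ x = 0 :=
  image_eq_zero_of_notMem_tsupport fun h => hx (hψ.2.2 h)

theorem IsTestFun.gradient_eq_zero {N : ℕ} {V : Set (EuclideanSpace ℝ (Fin N))}
    {ψ : EuclideanSpace ℝ (Fin N) → ℝ} (hψ : IsTestFun V ψ) {x : EuclideanSpace ℝ (Fin N)}
    (hx : x ∉ V) : gradient ψ x = 0 :=
  gradient_eq_zero_of_notMem_tsupport fun h => hx (hψ.2.2 h)

theorem IsWeakSolution.setIntegral_inner_pFlux {p : ℝ} {N : ℕ}
    {Ω V : Set (EuclideanSpace ℝ (Fin N))} {u : EuclideanSpace ℝ (Fin N) → ℝ}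
    (hu : IsWeakSolution p Ω u (fun _ => 1)) (hV : V ⊆ Ω)
    {ψ : EuclideanSpace ℝ (Fin N) → ℝ} (hψ : IsTestFun V ψ) :
    ∫ x in V, ⟪pFlux p (gradient u x), gradient ψ x⟫ = ∫ x, ψ x := by
  have h := hu ψ ⟨hψ.1, hψ.2.1, hψ.2.2.trans hV⟩
  simp_rw [one_mul, ← real_inner_smul_left] at h
  rw [setIntegral_eq_integral_of_forall_compl_eq_zero fun x hx => hψ.eq_zero fun h => hx (hV h),
    setIntegral_eq_integral_of_forall_compl_eq_zero fun x hx => by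
      rw [hψ.gradient_eq_zero fun h => hx (hV h), inner_zero_right]] at h
  rw [setIntegral_eq_integral_of_forall_compl_eq_zero fun x hx => by
    rw [hψ.gradient_eq_zero hx, inner_zero_right]]
  exact h

/-- The radial barrier with `κ ^ (p - 1) = 1 / N` solves `-Δ_p b = 1`. -/
theorem isWeakSolution_radialBarrier {p q κ : ℝ} (hpq : p.HolderConjugate q) (hκ : 0 < κ)
    {N : ℕ} (hN : N ≠ 0) (hκN : κ ^ (p - 1) = (N : ℝ)⁻¹) (R : ℝ)
    (z : EuclideanSpace ℝ (Fin N)) (V : Set (EuclideanSpace ℝ (Fin N))) :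
    IsWeakSolution p V (radialBarrier q κ R z) (fun _ => 1) := by
  intro ψ hψ
  have hflux (x : EuclideanSpace ℝ (Fin N)) :
      ‖gradient (radialBarrier q κ R z) x‖ ^ (p - 2) *
        ⟪gradient (radialBarrier q κ R z) x, gradient ψ x⟫
        = -(N : ℝ)⁻¹ * ⟪x - z, gradient ψ x⟫ := by
    rw [← real_inner_smul_left, ← pFlux, gradient_radialBarrier hpq.symm.lt,
      pFlux_neg_smul_pFlux hpq hκ, hκN, ← neg_smul, real_inner_smul_left]
  simp_rw [hflux, one_mul]
  rw [setIntegral_eq_integral_of_forall_compl_eq_zero fun x hx => hψ.eq_zero hx,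
    setIntegral_eq_integral_of_forall_compl_eq_zero fun x hx => by
      rw [hψ.gradient_eq_zero hx, inner_zero_right, mul_zero],
    integral_const_mul, integral_inner_sub_gradient z (hψ.1.of_le (by exact_mod_cast le_top))
      hψ.2.1]
  have : (N : ℝ) ≠ 0 := Nat.cast_ne_zero.2 hN
  field_simp

/-- Hopf-type boundary point lemma for the torsion function: if `y > 0` solves
`-Δ_p y = 1` in `Ω`, `B(z0,R) ⊆ Ω` and `x0 ∈ ∂B(z0,R) ∩ ∂Ω` with `y(x0) = 0`, then the
outward normal derivative of `y` at `x0` is strictly negative. -/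
theorem hopf_boundary_torsion
    (N : ℕ) (p : ℝ) (hp : 1 < p) (Ω : Set (EuclideanSpace ℝ (Fin N)))
    (hΩo : IsOpen Ω) (hΩbdd : Bornology.IsBounded Ω)
    (y : EuclideanSpace ℝ (Fin N) → ℝ)
    (hy1 : C1OnClosure Ω y) (hypos : ∀ x ∈ Ω, 0 < y x)
    (hysol : IsWeakSolution p Ω y (fun _ => 1))
    (z0 x0 : EuclideanSpace ℝ (Fin N)) (R : ℝ) (hR : 0 < R)
    (hball : Metric.ball z0 R ⊆ Ω)
    (hx0 : x0 ∈ Metric.sphere z0 R ∩ frontier Ω) (hyx0 : y x0 = 0) :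
    ⟪gradient y x0, R⁻¹ • (x0 - z0)⟫ < 0 := by
  obtain ⟨W, hW, hΩW, hyW⟩ := hy1
  have hx0s : ‖x0 - z0‖ = R := mem_sphere_iff_norm.1 hx0.1
  have hN : N ≠ 0 := by
    rintro rfl
    rw [Subsingleton.elim x0 z0, sub_self, norm_zero] at hx0s
    exact hR.ne hx0s
  set q := p.conjExponent
  have hpq : p.HolderConjugate q := Real.HolderConjugate.conjExponent hp
  set κ : ℝ := ((N : ℝ)⁻¹) ^ (p - 1)⁻¹
  have hNpos : 0 < (N : ℝ)⁻¹ := inv_pos.2 (Nat.cast_pos.2 (Nat.pos_of_ne_zero hN))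
  have hκ : 0 < κ := Real.rpow_pos_of_pos hNpos _
  have hκN : κ ^ (p - 1) = (N : ℝ)⁻¹ :=
    Real.rpow_inv_rpow hNpos.le (by linarith)
  set b := radialBarrier q κ R z0
  have hb : ContDiff ℝ 1 b := contDiff_radialBarrier hpq.symm.lt κ R z0
  have hb0 : ∀ x ∈ sphere z0 R, b x = 0 := fun x hx => by
    simp [b, radialBarrier, mem_sphere_iff_norm.1 hx]
  have hyΩ : ∀ x ∈ closure Ω, 0 ≤ y x := fun x hx =>
    le_on_closure (fun z hz => (hypos z hz).le) continuousOn_const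
      (hyW.continuousOn.mono hΩW) hx
  have hcl : closure (ball z0 R) ⊆ W := (closure_mono hball).trans hΩW
  have hint : ∀ {g : EuclideanSpace ℝ (Fin N) → ℝ}, ContDiffOn ℝ 1 g W → ∀ ψ,
      IsTestFun (ball z0 R) ψ →
      IntegrableOn (fun x => ⟪pFlux p (gradient g x), gradient ψ x⟫) (ball z0 R) := by
    intro g hg ψ hψ
    have hψ1 : ContDiff ℝ 1 ψ := hψ.1.of_le (by exact_mod_cast le_top)
    refine IntegrableOn.mono_set (ContinuousOn.integrableOn_compact
      isBounded_ball.isCompact_closure ?_) subset_closure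
    exact (((continuous_pFlux hp).comp_continuousOn (hg.continuousOn_gradient hW)).mono hcl).inner
      ((hψ1.contDiffOn.continuousOn_gradient isOpen_univ).mono (subset_univ _))
  have hcmp : ∀ x ∈ ball z0 R, b x ≤ y x := by
    refine le_of_weak_pLaplacian_eq hp isOpen_ball isBounded_ball ?_ hW hcl hyW hb.contDiffOn
      ?_ ?_
    · refine (ne_univ_iff_exists_notMem _).2 ⟨x0, fun h => ?_⟩
      exact (mem_ball_iff_norm.1 h).ne hx0s
    · intro x hx
      have hxs : x ∈ sphere z0 R := by rwa [frontier_ball z0 hR.ne'] at hx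
      rw [hb0 x hxs]
      exact hyΩ x (closure_mono hball hx.1)
    · intro ψ hψ
      simp_rw [inner_sub_left]
      rw [integral_sub (hint hb.contDiffOn ψ hψ) (hint hyW ψ hψ),
        hysol.setIntegral_inner_pFlux hball hψ,
        (isWeakSolution_radialBarrier hpq hκ hN hκN R z0 (ball z0 R)).setIntegral_inner_pFlux
          subset_rfl hψ, sub_self]
  have hyx : DifferentiableAt ℝ y x0 :=
    (hyW.contDiffAt (hW.mem_nhds (hΩW hx0.2.1))).differentiableAt one_ne_zero
  have hbx : DifferentiableAt ℝ b x0 := hb.differentiable one_ne_zero x0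
  have hle := inner_gradient_nonpos_of_le (z := z0) (hyx.sub hbx) fun t ht0 ht1 => by
    have hmem : x0 + t • (z0 - x0) ∈ ball z0 R := by
      rw [mem_ball_iff_norm, show x0 + t • (z0 - x0) - z0 = (1 - t) • (x0 - z0) by module,
        norm_smul, hx0s, Real.norm_of_nonneg (by linarith)]
      nlinarith
    simpa [hyx0, hb0 x0 hx0.1] using hcmp _ hmem
  have hgsub : gradient (y - b) x0 = gradient y x0 - gradient b x0 := by
    rw [gradient, fderiv_sub hyx hbx, map_sub]
    rfl
  have hbneg : ⟪gradient b x0, x0 - z0⟫ < 0 := by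
    rw [gradient_radialBarrier hpq.symm.lt, pFlux, inner_neg_left, real_inner_smul_left,
      real_inner_smul_left, real_inner_self_eq_norm_sq, hx0s, neg_lt_zero]
    positivity
  rw [hgsub, inner_sub_left] at hle
  rw [real_inner_smul_right]
  exact mul_neg_of_pos_of_neg (inv_pos.2 hR) (by linarith)

end
end

section
/- (Reflection comparison for the torsion function.) Let s ∈ (0, r1−r0) and let y_s be the torsion function of Ω(s). Then for every x = (x1,…,xN) ∈ Ω(s) with x1 > s one has y_s(x') ≥ y_s(x), where x' = (2s−x1, x2,…,xN) is the reflection of x across the hyperplane {x1 = s}. -/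
open MeasureTheory RealInnerProductSpace Metric Set

noncomputable section

open Filter Topology
open scoped Convolution

/-- The vector field `A(x) = |x|^{p-2} x`. -/
def powField (p : ℝ) {N : ℕ} (x : EuclideanSpace ℝ (Fin N)) : EuclideanSpace ℝ (Fin N) :=
  ‖x‖ ^ (p - 2) • x

lemma norm_powField {p : ℝ} (hp : 1 < p) {N : ℕ} (x : EuclideanSpace ℝ (Fin N)) :
    ‖powField p x‖ = ‖x‖ ^ (p - 1) := by
  rcases eq_or_ne x 0 with rfl | hx
  · simp [powField, Real.zero_rpow (by linarith : p - 1 ≠ 0)]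
  · have h : 0 < ‖x‖ := norm_pos_iff.2 hx
    rw [powField, norm_smul, Real.norm_of_nonneg (by positivity),
      show p - 1 = (p - 2) + 1 by ring, Real.rpow_add h, Real.rpow_one]

lemma continuous_powField {p : ℝ} (hp : 1 < p) {N : ℕ} :
    Continuous (powField p : EuclideanSpace ℝ (Fin N) → _) := by
  rw [continuous_iff_continuousAt]
  intro x
  rcases eq_or_ne x 0 with rfl | hx
  · have h0 : powField p (0 : EuclideanSpace ℝ (Fin N)) = 0 := by simp [powField]
    rw [ContinuousAt, h0, tendsto_zero_iff_norm_tendsto_zero]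
    simp_rw [norm_powField hp]
    have : ContinuousAt (fun x : EuclideanSpace ℝ (Fin N) => ‖x‖ ^ (p - 1)) 0 :=
      continuous_norm.continuousAt.rpow_const (Or.inr (by linarith))
    simpa [ContinuousAt, Real.zero_rpow (by linarith : p - 1 ≠ 0)] using this
  · exact (continuous_norm.continuousAt.rpow_const (Or.inl (norm_ne_zero_iff.2 hx))).smul
      continuousAt_id

lemma inner_powField_self {p : ℝ} {N : ℕ} (x : EuclideanSpace ℝ (Fin N)) :
    ⟪powField p x, x⟫ = ‖x‖ ^ (p - 1) * ‖x‖ := by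
  rcases eq_or_ne x 0 with rfl | hx
  · simp
  · have h : 0 < ‖x‖ := norm_pos_iff.2 hx
    rw [powField, real_inner_smul_left, real_inner_self_eq_norm_sq,
      show p - 1 = (p - 2) + 1 by ring, Real.rpow_add h, Real.rpow_one]
    ring

lemma mul_sub_le_inner_powField_sub {p : ℝ} (hp : 1 < p) {N : ℕ}
    (a b : EuclideanSpace ℝ (Fin N)) :
    (‖a‖ ^ (p - 1) - ‖b‖ ^ (p - 1)) * (‖a‖ - ‖b‖) ≤ ⟪powField p a - powField p b, a - b⟫ := by
  have h1 := real_inner_le_norm (powField p a) b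
  have h2 := real_inner_le_norm (powField p b) a
  rw [norm_powField hp] at h1 h2
  rw [inner_sub_left, inner_sub_right, inner_sub_right, inner_powField_self,
    inner_powField_self]
  linarith

lemma rpow_sub_mul_sub_nonneg_s14 {q : ℝ} (hq : 0 < q) {s t : ℝ} (hs : 0 ≤ s) (ht : 0 ≤ t) :
    0 ≤ (s ^ q - t ^ q) * (s - t) := by
  rcases le_total s t with h | h
  · exact mul_nonneg_of_nonpos_of_nonpos
      (sub_nonpos.2 (Real.rpow_le_rpow hs h hq.le)) (sub_nonpos.2 h)
  · exact mul_nonneg (sub_nonneg.2 (Real.rpow_le_rpow ht h hq.le)) (sub_nonneg.2 h)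

lemma inner_powField_sub_nonneg {p : ℝ} (hp : 1 < p) {N : ℕ}
    (a b : EuclideanSpace ℝ (Fin N)) : 0 ≤ ⟪powField p a - powField p b, a - b⟫ :=
  (rpow_sub_mul_sub_nonneg_s14 (by linarith) (norm_nonneg a) (norm_nonneg b)).trans
    (mul_sub_le_inner_powField_sub hp a b)

lemma eq_of_inner_powField_sub_eq_zero {p : ℝ} (hp : 1 < p) {N : ℕ}
    {a b : EuclideanSpace ℝ (Fin N)} (h : ⟪powField p a - powField p b, a - b⟫ = 0) : a = b := by
  have h1 := mul_sub_le_inner_powField_sub hp a b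
  have h2 := rpow_sub_mul_sub_nonneg_s14 (q := p - 1) (by linarith) (norm_nonneg a) (norm_nonneg b)
  have hab : ‖a‖ = ‖b‖ := by
    rcases mul_eq_zero.1 (le_antisymm (h1.trans h.le) h2) with h3 | h3
    · exact (Real.rpow_left_inj (norm_nonneg a) (norm_nonneg b) (by linarith)).1
        (sub_eq_zero.1 h3)
    · exact sub_eq_zero.1 h3
  rcases eq_or_ne b 0 with rfl | hb
  · exact norm_eq_zero.1 (by simpa using hab)
  · have hpos : 0 < ‖b‖ ^ (p - 2) := Real.rpow_pos_of_pos (norm_pos_iff.2 hb) _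
    rw [powField, powField, hab, ← smul_sub, real_inner_smul_left] at h
    exact sub_eq_zero.1 (inner_self_eq_zero.1 ((mul_eq_zero.1 h).resolve_left hpos.ne'))

/-- A compactly supported `C^1` function is a `C^1`-limit of test functions whose supports
stay in a fixed compact subset of `U`. -/
lemma exists_isTestFun_approx {N : ℕ} {U : Set (EuclideanSpace ℝ (Fin N))} (hU : IsOpen U)
    {φ : EuclideanSpace ℝ (Fin N) → ℝ} (hφ : ContDiff ℝ 1 φ) (hc : HasCompactSupport φ)
    (hs : tsupport φ ⊆ U) :
    ∃ K, IsCompact K ∧ K ⊆ U ∧ tsupport φ ⊆ K ∧ ∀ ε > 0, ∃ ψ, IsTestFun U ψ ∧ tsupport ψ ⊆ K ∧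
      ∀ x, |ψ x - φ x| ≤ ε ∧ ‖fderiv ℝ ψ x - fderiv ℝ φ x‖ ≤ ε := by
  obtain ⟨δ₀, hδ₀, hsub⟩ := hc.isCompact.exists_cthickening_subset_open hU hs
  refine ⟨cthickening δ₀ (tsupport φ), hc.isCompact.cthickening, hsub,
    self_subset_cthickening _, fun ε hε => ?_⟩
  have huc : UniformContinuous φ := hc.uniformContinuous_of_continuous hφ.continuous
  have hdc : Continuous (fderiv ℝ φ) := hφ.continuous_fderiv one_ne_zero
  have hduc : UniformContinuous (fderiv ℝ φ) :=
    (hc.fderiv ℝ).uniformContinuous_of_continuous hdc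
  obtain ⟨δ₁, hδ₁, h₁⟩ := Metric.uniformContinuous_iff.1 huc ε hε
  obtain ⟨δ₂, hδ₂, h₂⟩ := Metric.uniformContinuous_iff.1 hduc ε hε
  set δ := min δ₀ (min δ₁ δ₂)
  have hδpos : 0 < δ := by positivity
  let ρ : ContDiffBump (0 : EuclideanSpace ℝ (Fin N)) := ⟨δ / 2, δ, by positivity, by linarith⟩
  set ψ := (ρ.normed volume ⋆[ContinuousLinearMap.lsmul ℝ ℝ, volume] φ)
  have hsupp : tsupport ψ ⊆ cthickening δ₀ (tsupport φ) := by
    refine closure_minimal ?_ isClosed_cthickening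
    refine (support_convolution_subset _).trans ?_
    rintro _ ⟨a, ha, b, hb, rfl⟩
    rw [ρ.support_normed_eq] at ha
    refine mem_cthickening_of_dist_le _ b _ _ (subset_tsupport _ hb) ?_
    have : dist a 0 < δ := ha
    rw [dist_zero_right] at this
    simpa using this.le.trans (min_le_left _ _)
  have hderiv : ∀ x, fderiv ℝ ψ x =
      (ρ.normed volume ⋆[ContinuousLinearMap.lsmul ℝ ℝ, volume] fderiv ℝ φ) x := by
    intro x
    rw [(hc.hasFDerivAt_convolution_right (ContinuousLinearMap.lsmul ℝ ℝ)
      (ρ.continuous_normed.locallyIntegrable) hφ x).fderiv]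
    rfl
  refine ⟨ψ, ⟨?_, hc.isCompact.cthickening.of_isClosed_subset (isClosed_tsupport _) hsupp,
    hsupp.trans hsub⟩, hsupp, fun x => ⟨?_, ?_⟩⟩
  · exact ρ.hasCompactSupport_normed.contDiff_convolution_left _ ρ.contDiff_normed
      hφ.continuous.locallyIntegrable
  · exact ρ.dist_normed_convolution_le hφ.continuous.aestronglyMeasurable fun z hz =>
      (h₁ (lt_of_lt_of_le hz ((min_le_right _ _).trans (min_le_left _ _)))).le
  · rw [hderiv, ← dist_eq_norm]
    exact ρ.dist_normed_convolution_le hdc.aestronglyMeasurable fun z hz =>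
      (h₂ (lt_of_lt_of_le hz ((min_le_right _ _).trans (min_le_right _ _)))).le

/-- An identity in divergence form that holds for smooth test functions extends to `C^1` ones. -/
lemma integral_fderiv_eq_integral_of_isTestFun {N : ℕ} {U : Set (EuclideanSpace ℝ (Fin N))}
    (hU : IsOpen U) {F : EuclideanSpace ℝ (Fin N) → EuclideanSpace ℝ (Fin N)}
    (hF : ContinuousOn F U)
    (h : ∀ ψ, IsTestFun U ψ → ∫ x in U, fderiv ℝ ψ x (F x) = ∫ x in U, ψ x)
    {φ : EuclideanSpace ℝ (Fin N) → ℝ} (hφ : ContDiff ℝ 1 φ) (hc : HasCompactSupport φ)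
    (hs : tsupport φ ⊆ U) :
    ∫ x, fderiv ℝ φ x (F x) = ∫ x, φ x := by
  obtain ⟨K, hK, hKU, hφK, happ⟩ := exists_isTestFun_approx hU hφ hc hs
  obtain ⟨C, hC⟩ := hK.exists_bound_of_continuousOn (hF.mono hKU)
  have hfd : ∀ {ψ : EuclideanSpace ℝ (Fin N) → ℝ} {S : Set (EuclideanSpace ℝ (Fin N))},
      tsupport ψ ⊆ S → ∀ x, x ∉ S → fderiv ℝ ψ x (F x) = 0 := by
    intro ψ S hS x hx
    rw [fderiv_of_notMem_tsupport ℝ (fun h' => hx (hS h')), _root_.zero_apply]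
  have hint : ∀ {ψ : EuclideanSpace ℝ (Fin N) → ℝ}, ContDiff ℝ 1 ψ →
      IntegrableOn (fun x => fderiv ℝ ψ x (F x)) K ∧ IntegrableOn ψ K := fun {ψ} hψ =>
    ⟨(((hψ.continuous_fderiv one_ne_zero).continuousOn).clm_apply
      (hF.mono hKU)).integrableOn_compact hK, hψ.continuous.continuousOn.integrableOn_compact hK⟩
  have hint' : ∀ {ψ : EuclideanSpace ℝ (Fin N) → ℝ}, ContDiff ℝ 1 ψ →
      IntegrableOn (fun x => fderiv ℝ ψ x (F x) - ψ x) K := fun {ψ} hψ =>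
    (hint hψ).1.sub (hint hψ).2
  have key : ∀ {ψ : EuclideanSpace ℝ (Fin N) → ℝ}, ContDiff ℝ 1 ψ → tsupport ψ ⊆ K →
      ∀ S, K ⊆ S → ∫ x in K, (fderiv ℝ ψ x (F x) - ψ x) =
        (∫ x in S, fderiv ℝ ψ x (F x)) - ∫ x in S, ψ x := by
    intro ψ hψ hψK S hKS
    rw [integral_sub (hint hψ).1 (hint hψ).2]
    congr 1
    · rw [setIntegral_eq_integral_of_forall_compl_eq_zero fun x hx => hfd (hψK.trans hKS) x hx,
        setIntegral_eq_integral_of_forall_compl_eq_zero fun x hx => hfd hψK x hx]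
    · rw [setIntegral_eq_integral_of_forall_compl_eq_zero fun x hx =>
          image_eq_zero_of_notMem_tsupport fun h' => hx (hKS (hψK h')),
        setIntegral_eq_integral_of_forall_compl_eq_zero fun x hx =>
          image_eq_zero_of_notMem_tsupport fun h' => hx (hψK h')]
  have hzero : ∫ x in K, (fderiv ℝ φ x (F x) - φ x) = 0 := by
    set c : ℝ := (C + 1) * volume.real K
    have hbound : ∀ ε > 0, |∫ x in K, (fderiv ℝ φ x (F x) - φ x)| ≤ ε * c := by
      intro ε hε
      obtain ⟨ψ, hψ, hψK, hψφ⟩ := happ ε hε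
      have hψ1 : ContDiff ℝ 1 ψ := hψ.1.of_le (by exact_mod_cast le_top)
      have h0 : ∫ x in K, (fderiv ℝ ψ x (F x) - ψ x) = 0 := by
        rw [key hψ1 hψK U hKU, h ψ hψ, sub_self]
      rw [← sub_zero (∫ x in K, (fderiv ℝ φ x (F x) - φ x)), ← h0,
        ← integral_sub (hint' hφ) (hint' hψ1),
        ← Real.norm_eq_abs]
      refine (norm_setIntegral_le_of_norm_le_const (C := ε * (C + 1)) hK.measure_lt_top
        fun x hx => ?_).trans (by simp only [c, mul_assoc]; rfl)
      have h1 : ‖(fderiv ℝ ψ x - fderiv ℝ φ x) (F x)‖ ≤ ε * C :=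
        ((fderiv ℝ ψ x - fderiv ℝ φ x).le_opNorm _).trans
          (mul_le_mul (hψφ x).2 (hC x hx) (norm_nonneg _) hε.le)
      have h2 := (hψφ x).1
      calc ‖fderiv ℝ φ x (F x) - φ x - (fderiv ℝ ψ x (F x) - ψ x)‖
          = ‖(ψ x - φ x) - (fderiv ℝ ψ x - fderiv ℝ φ x) (F x)‖ := by
            rw [_root_.sub_apply]; congr 1; ring
        _ ≤ ‖ψ x - φ x‖ + ‖(fderiv ℝ ψ x - fderiv ℝ φ x) (F x)‖ := norm_sub_le _ _
        _ ≤ ε + ε * C := add_le_add h2 h1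
        _ = ε * (C + 1) := by ring
    have hlim : Tendsto (fun ε : ℝ => ε * c) (𝓝[>] 0) (𝓝 0) := by
      have : Tendsto (fun ε : ℝ => ε * c) (𝓝 0) (𝓝 (0 * c)) := tendsto_id.mul_const c
      rw [zero_mul] at this
      exact this.mono_left nhdsWithin_le_nhds
    exact abs_nonpos_iff.1 (ge_of_tendsto hlim (eventually_mem_nhdsWithin.mono hbound))
  have := key hφ hφK univ (subset_univ _)
  simp only [setIntegral_univ] at this
  linarith

lemma continuousOn_gradient {N : ℕ} {U : Set (EuclideanSpace ℝ (Fin N))} (hU : IsOpen U)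
    {u : EuclideanSpace ℝ (Fin N) → ℝ} (hu : ContDiffOn ℝ 1 u U) :
    ContinuousOn (gradient u) U :=
  (InnerProductSpace.toDual ℝ _).symm.continuous.comp_continuousOn
    (hu.continuousOn_fderiv_of_isOpen hU le_rfl)

lemma continuous_fderiv_apply {N : ℕ} {U : Set (EuclideanSpace ℝ (Fin N))} (hU : IsOpen U)
    {F : EuclideanSpace ℝ (Fin N) → EuclideanSpace ℝ (Fin N)} (hF : ContinuousOn F U)
    {φ : EuclideanSpace ℝ (Fin N) → ℝ} (hφ : ContDiff ℝ 1 φ) (hs : tsupport φ ⊆ U) :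
    Continuous fun x => fderiv ℝ φ x (F x) := by
  rw [continuous_iff_continuousAt]
  intro x
  by_cases hx : x ∈ tsupport φ
  · exact (hφ.continuous_fderiv one_ne_zero).continuousAt.clm_apply
      (hF.continuousAt (hU.mem_nhds (hs hx)))
  · refine (continuousAt_const (y := (0 : ℝ))).congr ?_
    filter_upwards [(isClosed_tsupport φ).isOpen_compl.mem_nhds hx] with z hz
    rw [fderiv_of_notMem_tsupport ℝ hz, _root_.zero_apply]

lemma hasCompactSupport_fderiv_apply {N : ℕ}
    (F : EuclideanSpace ℝ (Fin N) → EuclideanSpace ℝ (Fin N))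
    {φ : EuclideanSpace ℝ (Fin N) → ℝ} (hc : HasCompactSupport φ) :
    HasCompactSupport fun x => fderiv ℝ φ x (F x) :=
  HasCompactSupport.intro hc.isCompact fun x hx => by
    rw [fderiv_of_notMem_tsupport ℝ hx, _root_.zero_apply]

/-- Weak comparison principle for the `p`-Laplacian. -/
lemma le_of_integral_fderiv_powField_eq {p : ℝ} (hp : 1 < p) {N : ℕ}
    {D : Set (EuclideanSpace ℝ (Fin N))} (hD : IsOpen D) (hb : Bornology.IsBounded D)
    (hne : D ≠ univ) {u v : EuclideanSpace ℝ (Fin N) → ℝ}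
    (hu : ContDiffOn ℝ 1 u D) (hv : ContDiffOn ℝ 1 v D)
    (huc : ContinuousOn u (closure D)) (hvc : ContinuousOn v (closure D))
    (hle : ∀ x ∈ closure D, x ∉ D → u x ≤ v x)
    (heq : ∀ φ : EuclideanSpace ℝ (Fin N) → ℝ, ContDiff ℝ 1 φ → HasCompactSupport φ →
      tsupport φ ⊆ D →
      ∫ x, fderiv ℝ φ x (powField p (gradient u x)) =
        ∫ x, fderiv ℝ φ x (powField p (gradient v x))) :
    ∀ x ∈ D, u x ≤ v x := by
  intro x hx
  refine le_of_forall_pos_le_add fun ε hε => ?_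
  let w : EuclideanSpace ℝ (Fin N) → ℝ := fun z => u z - v z - ε
  let φ : EuclideanSpace ℝ (Fin N) → ℝ := D.indicator fun z => expNegInvGlue (w z)
  let K : Set (EuclideanSpace ℝ (Fin N)) := closure D ∩ w ⁻¹' Ici 0
  have hwc : ContinuousOn w (closure D) := (huc.sub hvc).sub continuousOn_const
  have hK : IsCompact K := hb.isCompact_closure.of_isClosed_subset
    (hwc.preimage_isClosed_of_isClosed isClosed_closure isClosed_Ici) inter_subset_left
  have hKD : K ⊆ D := by
    rintro z ⟨hz, hz'⟩
    by_contra hzD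
    have h1 := hle z hz hzD
    have h2 : 0 ≤ u z - v z - ε := hz'
    linarith
  have hφ0 : ∀ z, z ∉ K → φ z = 0 := by
    intro z hz
    by_cases hzD : z ∈ D
    · have : w z ≤ 0 := by
        by_contra! hlt
        exact hz ⟨subset_closure hzD, hlt.le⟩
      simp only [φ, indicator_of_mem hzD, expNegInvGlue.zero_of_nonpos this]
    · exact indicator_of_notMem hzD _
  have hsupp : tsupport φ ⊆ K :=
    closure_minimal (fun z hz => by_contra fun h => hz (hφ0 z h)) hK.isClosed
  have hφc : HasCompactSupport φ := HasCompactSupport.intro hK hφ0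
  have hw : ∀ z ∈ D, ContDiffAt ℝ 1 w z := fun z hz =>
    ((hu.contDiffAt (hD.mem_nhds hz)).sub (hv.contDiffAt (hD.mem_nhds hz))).sub contDiffAt_const
  have hφD : ∀ z ∈ D, φ =ᶠ[𝓝 z] fun z => expNegInvGlue (w z) := fun z hz => by
    filter_upwards [hD.mem_nhds hz] with t ht using indicator_of_mem ht _
  have hφ1 : ContDiff ℝ 1 φ := by
    rw [contDiff_iff_contDiffAt]
    intro z
    by_cases hz : z ∈ K
    · exact (expNegInvGlue.contDiff.contDiffAt.comp z (hw z (hKD hz))).congr_of_eventuallyEq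
        (hφD z (hKD hz))
    · refine (contDiffAt_const (c := (0 : ℝ))).congr_of_eventuallyEq ?_
      filter_upwards [hK.isClosed.isOpen_compl.mem_nhds hz] with t ht using hφ0 t ht
  have hderiv : ∀ z ∈ D, fderiv ℝ φ z =
      deriv expNegInvGlue (w z) • (fderiv ℝ u z - fderiv ℝ v z) := by
    intro z hz
    have h1 : HasFDerivAt w (fderiv ℝ u z - fderiv ℝ v z) z :=
      ((((hu.contDiffAt (hD.mem_nhds hz)).differentiableAt one_ne_zero).hasFDerivAt).sub
        (((hv.contDiffAt (hD.mem_nhds hz)).differentiableAt one_ne_zero).hasFDerivAt)).sub_const ε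
    have h2 : HasDerivAt expNegInvGlue (deriv expNegInvGlue (w z)) (w z) :=
      ((expNegInvGlue.contDiff (n := 1)).differentiable one_ne_zero _).hasDerivAt
    rw [(hφD z hz).fderiv_eq]
    exact (h2.comp_hasFDerivAt z h1).fderiv
  have hFu : ContinuousOn (fun z => powField p (gradient u z)) D :=
    (continuous_powField hp).comp_continuousOn (continuousOn_gradient hD hu)
  have hFv : ContinuousOn (fun z => powField p (gradient v z)) D :=
    (continuous_powField hp).comp_continuousOn (continuousOn_gradient hD hv)
  let H : EuclideanSpace ℝ (Fin N) → ℝ := fun z =>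
    fderiv ℝ φ z (powField p (gradient u z) - powField p (gradient v z))
  have hHc : Continuous H := continuous_fderiv_apply hD (hFu.sub hFv) hφ1 (hsupp.trans hKD)
  have hHs : HasCompactSupport H := hasCompactSupport_fderiv_apply _ hφc
  have hHint : ∫ z, H z = 0 := by
    simp only [H, map_sub]
    rw [integral_sub, heq φ hφ1 hφc (hsupp.trans hKD), sub_self]
    · exact (continuous_fderiv_apply hD hFu hφ1
        (hsupp.trans hKD)).integrable_of_hasCompactSupport (hasCompactSupport_fderiv_apply _ hφc)
    · exact (continuous_fderiv_apply hD hFv hφ1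
        (hsupp.trans hKD)).integrable_of_hasCompactSupport (hasCompactSupport_fderiv_apply _ hφc)
  have hHD : ∀ z ∈ D, H z = deriv expNegInvGlue (w z) *
      ⟪powField p (gradient u z) - powField p (gradient v z), gradient u z - gradient v z⟫ := by
    intro z hz
    simp only [H, hderiv z hz]
    rw [_root_.smul_apply, _root_.sub_apply, smul_eq_mul,
      real_inner_comm, inner_sub_left, inner_gradient_left, inner_gradient_left]
  have hg : ∀ t, 0 ≤ deriv expNegInvGlue t := fun t => expNegInvGlue.monotone.deriv_nonneg
  have hfdK : ∀ z, z ∉ D → fderiv ℝ φ z = 0 := fun z hz =>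
    fderiv_of_notMem_tsupport ℝ fun h => hz (hKD (hsupp h))
  have hHnn : 0 ≤ H := by
    intro z
    by_cases hz : z ∈ D
    · rw [hHD z hz]
      exact mul_nonneg (hg _) (inner_powField_sub_nonneg hp _ _)
    · simp [H, hfdK z hz]
  have hH0 : ∀ z, H z = 0 := fun z => by
    by_contra hz
    exact (hHc.integral_pos_of_hasCompactSupport_nonneg_nonzero (μ := volume) hHs hHnn hz).ne'
      hHint
  have hfd : ∀ z, fderiv ℝ φ z = 0 := by
    intro z
    by_cases hz : z ∈ D
    · rw [hderiv z hz]
      have h0 := hH0 z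
      rw [hHD z hz] at h0
      rcases mul_eq_zero.1 h0 with h | h
      · rw [h, zero_smul]
      · have h' := eq_of_inner_powField_sub_eq_zero hp h
        rw [← toDual_gradient, ← toDual_gradient, h', sub_self, smul_zero]
    · exact hfdK z hz
  obtain ⟨x₀, hx₀⟩ := (ne_univ_iff_exists_notMem D).1 hne
  have hφx : φ x = 0 := by
    rw [is_const_of_fderiv_eq_zero (hφ1.differentiable one_ne_zero) hfd x x₀]
    exact indicator_of_notMem hx₀ _
  have hwx : w x ≤ 0 := by
    by_contra! hlt
    simp only [φ, indicator_of_mem hx] at hφx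
    exact (expNegInvGlue.pos_of_pos hlt).ne' hφx
  have : u x - v x - ε ≤ 0 := hwx
  linarith

/-- The linear reflection across the hyperplane `{x₁ = 0}`. -/
def reflectL {N : ℕ} (hN : 2 ≤ N) :
    EuclideanSpace ℝ (Fin N) ≃ₗᵢ[ℝ] EuclideanSpace ℝ (Fin N) :=
  (ℝ ∙ e1v hN)ᗮ.reflection

lemma norm_e1v {N : ℕ} (hN : 2 ≤ N) : ‖(e1v hN : EuclideanSpace ℝ (Fin N))‖ = 1 := by
  simp [e1v]

lemma inner_e1v {N : ℕ} (hN : 2 ≤ N) (x : EuclideanSpace ℝ (Fin N)) :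
    ⟪e1v hN, x⟫ = x (firstIdx N hN) := by
  simp [e1v, EuclideanSpace.inner_single_left]

lemma reflectL_apply {N : ℕ} (hN : 2 ≤ N) (x : EuclideanSpace ℝ (Fin N)) :
    reflectL hN x = x - (2 * x (firstIdx N hN)) • e1v hN := by
  rw [reflectL, Submodule.reflection_orthogonal_apply, Submodule.reflection_singleton_apply,
    inner_e1v, norm_e1v]
  simp [mul_smul, two_smul]

lemma reflectH_eq {N : ℕ} (hN : 2 ≤ N) (s : ℝ) (x : EuclideanSpace ℝ (Fin N)) :
    reflectH hN s x = reflectL hN x + (2 * s) • e1v hN := by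
  rw [reflectH, reflectL_apply]
  module

lemma inner_reflectL_left {N : ℕ} (hN : 2 ≤ N) (x z : EuclideanSpace ℝ (Fin N)) :
    ⟪reflectL hN x, z⟫ = ⟪x, reflectL hN z⟫ := by
  rw [← (reflectL hN).inner_map_map x]
  simp [reflectL]

lemma reflectH_firstIdx {N : ℕ} (hN : 2 ≤ N) (s : ℝ) (x : EuclideanSpace ℝ (Fin N)) :
    reflectH hN s x (firstIdx N hN) = 2 * s - x (firstIdx N hN) := by
  simp [reflectH, e1v]
  ring

lemma reflectH_reflectH {N : ℕ} (hN : 2 ≤ N) (s : ℝ) (x : EuclideanSpace ℝ (Fin N)) :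
    reflectH hN s (reflectH hN s x) = x := by
  conv_lhs => rw [reflectH, reflectH_firstIdx, reflectH]
  module

lemma reflectH_center {N : ℕ} (hN : 2 ≤ N) (s : ℝ) :
    reflectH hN s (s • e1v hN) = s • e1v hN := by
  simp [reflectH, e1v]

lemma isometry_reflectH {N : ℕ} (hN : 2 ≤ N) (s : ℝ) : Isometry (reflectH hN s) := by
  refine Isometry.of_dist_eq fun x z => ?_
  rw [reflectH_eq, reflectH_eq, dist_add_right, (reflectL hN).dist_map]

lemma measurePreserving_reflectH {N : ℕ} (hN : 2 ≤ N) (s : ℝ) :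
    MeasurePreserving (reflectH hN s) := by
  rw [funext (reflectH_eq hN s)]
  exact (measurePreserving_add_right volume ((2 * s) • e1v hN)).comp
    (reflectL hN).measurePreserving

lemma norm_reflectH_sq {N : ℕ} (hN : 2 ≤ N) (s : ℝ) (x : EuclideanSpace ℝ (Fin N)) :
    ‖reflectH hN s x‖ ^ 2 = ‖x‖ ^ 2 + 4 * (s - x (firstIdx N hN)) * s := by
  rw [reflectH, norm_add_sq_real, norm_smul, norm_e1v, inner_smul_right, real_inner_comm,
    inner_e1v, Real.norm_eq_abs, mul_one, sq_abs]
  ring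

lemma hasFDerivAt_reflectH {N : ℕ} (hN : 2 ≤ N) (s : ℝ) (x : EuclideanSpace ℝ (Fin N)) :
    HasFDerivAt (reflectH hN s)
      ((reflectL hN).toContinuousLinearEquiv : EuclideanSpace ℝ (Fin N) →L[ℝ] _) x := by
  rw [funext (reflectH_eq hN s)]
  exact (reflectL hN).toContinuousLinearEquiv.hasFDerivAt.add_const _

lemma contDiff_reflectH {N : ℕ} (hN : 2 ≤ N) (s : ℝ) {n : WithTop ℕ∞} :
    ContDiff ℝ n (reflectH hN s) := by
  rw [funext (reflectH_eq hN s)]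
  exact (reflectL hN).contDiff.add contDiff_const

lemma fderiv_comp_reflectH {N : ℕ} (hN : 2 ≤ N) (s : ℝ) {f : EuclideanSpace ℝ (Fin N) → ℝ}
    {x : EuclideanSpace ℝ (Fin N)} (hf : DifferentiableAt ℝ f (reflectH hN s x))
    (v : EuclideanSpace ℝ (Fin N)) :
    fderiv ℝ (f ∘ reflectH hN s) x v = fderiv ℝ f (reflectH hN s x) (reflectL hN v) := by
  rw [(hf.hasFDerivAt.comp x (hasFDerivAt_reflectH hN s x)).fderiv]
  rfl

lemma gradient_comp_reflectH {N : ℕ} (hN : 2 ≤ N) (s : ℝ) {f : EuclideanSpace ℝ (Fin N) → ℝ}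
    {x : EuclideanSpace ℝ (Fin N)} (hf : DifferentiableAt ℝ f (reflectH hN s x)) :
    gradient (f ∘ reflectH hN s) x = reflectL hN (gradient f (reflectH hN s x)) := by
  refine ext_inner_right ℝ fun v => ?_
  rw [inner_gradient_left, fderiv_comp_reflectH hN s hf, inner_reflectL_left, inner_gradient_left]

lemma powField_reflectL {N : ℕ} (hN : 2 ≤ N) (p : ℝ) (x : EuclideanSpace ℝ (Fin N)) :
    powField p (reflectL hN x) = reflectL hN (powField p x) := by
  rw [powField, powField, (reflectL hN).norm_map, map_smul]

lemma isOpen_annulus {N : ℕ} (hN : 2 ≤ N) (r0 r1 s : ℝ) : IsOpen (annulus hN r0 r1 s) :=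
  isOpen_ball.sdiff isClosed_closure

lemma reflectH_mem_annulus {N : ℕ} (hN : 2 ≤ N) {r0 r1 s : ℝ} (hr0 : 0 < r0) (hs : 0 < s)
    {x : EuclideanSpace ℝ (Fin N)} (hx : x ∈ annulus hN r0 r1 s)
    (hxs : s < x (firstIdx N hN)) : reflectH hN s x ∈ annulus hN r0 r1 s := by
  obtain ⟨h1, h2⟩ := hx
  rw [closure_ball _ hr0.ne', mem_closedBall] at h2
  rw [mem_ball_zero_iff] at h1
  refine ⟨?_, ?_⟩
  · rw [mem_ball_zero_iff]
    refine lt_of_le_of_lt (abs_le_of_sq_le_sq' ?_ (norm_nonneg x)).2 h1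
    rw [norm_reflectH_sq]
    nlinarith
  · rw [closure_ball _ hr0.ne', mem_closedBall]
    conv in dist _ _ => rw [← reflectH_center hN s]
    rwa [(isometry_reflectH hN s).dist_eq]

/-- Reflection comparison for the torsion function: for `s ∈ (0, r1-r0)` and `x ∈ Ω(s)`
with `x₁ > s`, the torsion function satisfies `y_s(x') ≥ y_s(x)`, where `x'` is the
reflection of `x` across the hyperplane `{x₁ = s}`. -/
theorem reflection_comparison_torsion
    (N : ℕ) (hN : 2 ≤ N) (p : ℝ) (hp : 1 < p) (r0 r1 : ℝ)
    (hr0 : 0 < r0) (hr01 : r0 < r1)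
    (s : ℝ) (hs : s ∈ Set.Ioo 0 (r1 - r0))
    (y : EuclideanSpace ℝ (Fin N) → ℝ)
    (hy : IsTorsionFn p (annulus hN r0 r1 s) y) :
    ∀ x ∈ annulus hN r0 r1 s, s < x (firstIdx N hN) → y x ≤ y (reflectH hN s x) := by
  obtain ⟨⟨W, hW, hΩW, hyW⟩, hbd, hpos, hweak⟩ := hy
  set Ω := annulus hN r0 r1 s
  set R := reflectH hN s with hR
  have hΩo : IsOpen Ω := isOpen_annulus hN r0 r1 s
  have hyΩ : ContDiffOn ℝ 1 y Ω := hyW.mono (subset_closure.trans hΩW)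
  have hRc : Continuous R := (isometry_reflectH hN s).continuous
  let D : Set (EuclideanSpace ℝ (Fin N)) := Ω ∩ {x | s < x (firstIdx N hN)}
  have hcoord : Continuous fun x : EuclideanSpace ℝ (Fin N) => x (firstIdx N hN) := by fun_prop
  have hD : IsOpen D := hΩo.inter (isOpen_lt continuous_const hcoord)
  have hDΩ : D ⊆ Ω := inter_subset_left
  have hRD : MapsTo R D Ω := fun x hx => reflectH_mem_annulus hN hr0 hs.1 hx.1 hx.2
  have hcl : closure D ⊆ closure Ω := closure_mono hDΩ
  have hRcl : MapsTo R (closure D) (closure Ω) := hRD.closure hRc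
  have hynn : ∀ x ∈ closure Ω, 0 ≤ y x := fun x hx => by
    by_cases hxΩ : x ∈ Ω
    · exact (hpos x hxΩ).le
    · exact (hbd x ⟨hx, by rwa [hΩo.interior_eq]⟩).ge
  have hdiff : ∀ x ∈ Ω, DifferentiableAt ℝ y x := fun x hx =>
    (hyΩ.contDiffAt (hΩo.mem_nhds hx)).differentiableAt one_ne_zero
  let F : EuclideanSpace ℝ (Fin N) → EuclideanSpace ℝ (Fin N) := fun x =>
    powField p (gradient y x)
  have hF : ContinuousOn F Ω :=
    (continuous_powField hp).comp_continuousOn (continuousOn_gradient hΩo hyΩ)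
  have hweak' : ∀ φ : EuclideanSpace ℝ (Fin N) → ℝ, ContDiff ℝ 1 φ → HasCompactSupport φ →
      tsupport φ ⊆ Ω → ∫ x, fderiv ℝ φ x (F x) = ∫ x, φ x := fun φ hφ hc hs =>
    integral_fderiv_eq_integral_of_isTestFun hΩo hF (fun ψ hψ => by
      have h := hweak ψ hψ
      simp only [one_mul] at h
      rw [← h]
      congr 1 with x
      rw [← inner_gradient_left, real_inner_comm]
      exact real_inner_smul_left _ _ _) hφ hc hs
  have hmain := le_of_integral_fderiv_powField_eq (u := y) (v := y ∘ R) hp hD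
    (isBounded_ball.subset (hDΩ.trans sdiff_subset)) ?_ (hyΩ.mono hDΩ)
    (hyΩ.comp (contDiff_reflectH hN s).contDiffOn hRD) (hyW.continuousOn.mono (hcl.trans hΩW))
    ((hyW.continuousOn.mono hΩW).comp hRc.continuousOn hRcl) ?_ ?_
  · exact fun x hx hxs => hmain x ⟨hx, hxs⟩
  · refine (ne_univ_iff_exists_notMem D).2 ⟨0, fun h => ?_⟩
    have : s < (0 : EuclideanSpace ℝ (Fin N)) (firstIdx N hN) := h.2
    exact absurd hs.1 (not_lt.2 (by simpa using this.le))
  · intro x hx hxD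
    by_cases hxΩ : x ∈ Ω
    · have h1 : s ≤ x (firstIdx N hN) :=
        closure_minimal (fun z hz => le_of_lt hz.2) (isClosed_le continuous_const hcoord) hx
      have h2 : ¬ s < x (firstIdx N hN) := fun h => hxD ⟨hxΩ, h⟩
      have h3 : R x = x := by
        rw [hR, reflectH, le_antisymm (not_lt.1 h2) h1]
        simp
      rw [Function.comp_apply, h3]
    · rw [hbd x ⟨hcl hx, by rwa [hΩo.interior_eq]⟩]
      exact hynn _ (hRcl hx)
  · intro φ hφ hc hsD
    have hRR : ∀ x, R (R x) = x := reflectH_reflectH hN s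
    have hts : tsupport (φ ∘ R) ⊆ R ⁻¹' tsupport φ := tsupport_comp_subset_preimage φ hRc
    have hemb : MeasurableEmbedding R :=
      (isometry_reflectH hN s).isClosedEmbedding.measurableEmbedding
    have h1 := hweak' φ hφ hc (hsD.trans hDΩ)
    have hc' : HasCompactSupport (φ ∘ R) :=
      hc.comp_isClosedEmbedding (isometry_reflectH hN s).isClosedEmbedding
    have h2 := hweak' (φ ∘ R) (hφ.comp (contDiff_reflectH hN s)) hc' fun x hx => by
      rw [← hRR x]
      exact hRD (hsD (hts hx))
    have hmp : MeasurePreserving R := measurePreserving_reflectH hN s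
    rw [h1, ← hmp.integral_comp hemb φ,
      ← hmp.integral_comp hemb fun x => fderiv ℝ φ x (powField p (gradient (y ∘ R) x))]
    refine h2.symm.trans (integral_congr_ae (Filter.Eventually.of_forall fun x => ?_))
    simp only
    rw [fderiv_comp_reflectH hN s (hφ.differentiable one_ne_zero _)]
    by_cases hx : R x ∈ tsupport φ
    · have hxΩ : x ∈ Ω := hRR x ▸ hRD (hsD hx)
      rw [gradient_comp_reflectH hN s (by rw [← hR, hRR]; exact hdiff x hxΩ), ← hR, hRR,
        powField_reflectL]
    · rw [fderiv_of_notMem_tsupport ℝ hx, _root_.zero_apply, _root_.zero_apply]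

end
end
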